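/- For every real p > 1 there exist constants 0 < c ≤ C such that for all a, b ∈ ℝ: c·(b − a)²·(max(|a|, |b|))^{p−2} ≤ F_p(a, b) ≤ C·(b − a)²·(max(|a|, |b|))^{p−2}, where in the degenerate case a = b = 0 (and, for p < 2, whenever a = b) both outer expressions are interpreted as 0. -/

import Mathlib

/-- `lsgn` is the left derivative of `x ↦ |x|`: it equals `1` for `x > 0` and `-1` for `x ≤ 0`. -/
noncomputable def lsgn (x : ℝ) : ℝ := if 0 < x then 1 else -1

/-- The Bregman divergence of `x ↦ |x| ^ p`:
`F_p(a,b) = |b|^p − |a|^p − p · lsgn a · |a|^(p-1) · (b − a)`. -/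
noncomputable def Fp (p a b : ℝ) : ℝ :=
  |b| ^ p - |a| ^ p - p * lsgn a * |a| ^ (p - 1) * (b - a)

/-- Version of `Fp` for `0 ≤ a`, continuous everywhere. -/
noncomputable def Gp (p a b : ℝ) : ℝ :=
  |b| ^ p - |a| ^ p - p * |a| ^ (p - 1) * (b - a)

theorem Fp_eq_Gp (p a b : ℝ) (hp : 1 < p) (ha : 0 ≤ a) : Fp p a b = Gp p a b := by
  rcases ha.eq_or_lt with h | h
  · subst h
    have : (0:ℝ) ^ (p - 1) = 0 := Real.zero_rpow (by linarith)
    simp [Fp, Gp, this]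
  · simp [Fp, Gp, lsgn, h]

theorem Fp_neg (p a b : ℝ) (hp : 1 < p) : Fp p (-a) (-b) = Fp p a b := by
  have h0 : (0:ℝ) ^ (p - 1) = 0 := Real.zero_rpow (by linarith)
  rcases lt_trichotomy a 0 with h | h | h
  · simp only [Fp, lsgn, abs_neg, if_pos (neg_pos.2 h), if_neg h.not_gt]; ring
  · subst h; simp [Fp, h0]
  · have : ¬ (0 < -a) := by linarith
    simp only [Fp, lsgn, abs_neg, if_pos h, if_neg this]; ring

theorem Gp_scale (p a b l : ℝ) (hl : 0 < l) :
    Gp p (l * a) (l * b) = l ^ p * Gp p a b := by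
  have h1 : l ^ p = l ^ (p - 1) * l := by
    rw [← Real.rpow_add_one hl.ne']; ring_nf
  simp only [Gp, abs_mul, abs_of_pos hl, Real.mul_rpow hl.le (abs_nonneg _)]
  rw [h1]; ring

theorem Gp_cont (p : ℝ) (hp : 1 < p) : Continuous (fun x : ℝ × ℝ => Gp p x.1 x.2) := by
  unfold Gp
  have e1 : ∀ f : ℝ × ℝ → ℝ, Continuous f → Continuous (fun x => |f x| ^ p) := fun f hf =>
    hf.abs.rpow_const (fun _ => Or.inr (by linarith))
  have e2 : ∀ f : ℝ × ℝ → ℝ, Continuous f → Continuous (fun x => |f x| ^ (p - 1)) := fun f hf =>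
    hf.abs.rpow_const (fun _ => Or.inr (by linarith))
  exact ((e1 _ continuous_snd).sub (e1 _ continuous_fst)).sub
    ((continuous_const.mul (e2 _ continuous_fst)).mul (continuous_snd.sub continuous_fst))

theorem Gp_pos (p a b : ℝ) (hp : 1 < p) (ha : 0 ≤ a) (hab : a ≠ b) : 0 < Gp p a b := by
  rcases ha.eq_or_lt with h | h
  · subst h
    have h0 : (0:ℝ) ^ (p - 1) = 0 := Real.zero_rpow (by linarith)
    have h1 : (0:ℝ) ^ p = 0 := Real.zero_rpow (by linarith)
    have : 0 < |b| := abs_pos.2 hab.symm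
    simp only [Gp, abs_zero, h0, h1]
    have := Real.rpow_pos_of_pos this p
    linarith
  · have e : Gp p a b = a ^ p * Gp p 1 (b / a) := by
      rw [← Gp_scale p 1 (b / a) a h]; congr 1 <;> field_simp
    rw [e]
    have h1 : b / a ≠ 1 := by
      intro h2; rw [div_eq_one_iff_eq h.ne'] at h2; exact hab h2.symm
    generalize b / a = t at h1
    refine mul_pos (Real.rpow_pos_of_pos h p) ?_
    simp only [Gp, abs_one, Real.one_rpow]
    rcases le_or_gt 0 t with ht | ht
    · have := one_add_mul_self_lt_rpow_one_add (s := t - 1) (by linarith)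
        (sub_ne_zero.2 h1) hp
      rw [abs_of_nonneg ht]
      rw [show 1 + (t - 1) = t by ring] at this
      linarith
    · have := Real.rpow_nonneg (abs_nonneg t) p
      nlinarith

theorem tangent {f : ℝ → ℝ} {S : Set ℝ} (hf : ConvexOn ℝ S f) {a b d : ℝ} (ha : a ∈ S)
    (hb : b ∈ S) (hd : HasDerivAt f d a) : 0 ≤ f b - f a - d * (b - a) := by
  rcases lt_trichotomy a b with h | h | h
  · have := hf.le_slope_of_hasDerivAt ha hb h hd
    rw [slope_def_field, le_div_iff₀ (by linarith)] at this
    linarith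
  · subst h; simp
  · have := hf.slope_le_of_hasDerivAt hb ha h hd
    rw [slope_def_field, div_le_iff₀ (by linarith)] at this
    linarith

theorem near (p : ℝ) (hp : 1 < p) : ∃ k K : ℝ, 0 < k ∧ ∀ a ∈ Set.Icc (1/2:ℝ) 1,
    ∀ b ∈ Set.Icc (1/2:ℝ) 1, k * (b - a) ^ 2 ≤ Gp p a b ∧ Gp p a b ≤ K * (b - a) ^ 2 := by
  have hc : ContinuousOn (fun x : ℝ => x ^ (p - 2)) (Set.Icc (1/2:ℝ) 1) := by
    intro x hx
    exact (Real.continuousAt_rpow_const x _ (Or.inl (by linarith [hx.1]))).continuousWithinAt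
  have hne : (Set.Icc (1/2:ℝ) 1).Nonempty := ⟨1, by norm_num⟩
  obtain ⟨x, hx, hmin⟩ := isCompact_Icc.exists_isMinOn hne hc
  obtain ⟨y, hy, hmax⟩ := isCompact_Icc.exists_isMaxOn hne hc
  have hp1 : 0 < p * (p - 1) := mul_pos (by linarith) (by linarith)
  have d1 : ∀ s q : ℝ, ∀ z ∈ Set.Icc (1/2:ℝ) 1,
      HasDerivAt (fun z => s * z ^ p + q * z ^ 2) (s * (p * z ^ (p - 1)) + q * (2 * z)) z := by
    intro s q z hz
    have := (Real.hasDerivAt_rpow_const (x := z) (p := p) (Or.inl (by linarith [hz.1])))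
    have h2 := hasDerivAt_pow 2 z
    exact ((this.const_mul s).add (h2.const_mul q)).congr_deriv (by norm_num)
  have d2 : ∀ s q : ℝ, ∀ z ∈ Set.Icc (1/2:ℝ) 1,
      HasDerivAt (fun z => s * (p * z ^ (p - 1)) + q * (2 * z))
        (s * (p * ((p - 1) * z ^ (p - 2))) + q * 2) z := by
    intro s q z hz
    have := (Real.hasDerivAt_rpow_const (x := z) (p := p - 1) (Or.inl (by linarith [hz.1])))
    rw [show p - 1 - 1 = p - 2 by ring] at this
    have h2 := (hasDerivAt_id z).const_mul 2
    exact (((this.const_mul p).const_mul s).add (h2.const_mul q)).congr_deriv (by norm_num)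
  have conv : ∀ s q : ℝ, (∀ z ∈ Set.Icc (1/2:ℝ) 1,
      0 ≤ s * (p * ((p - 1) * z ^ (p - 2))) + q * 2) → ∀ a ∈ Set.Icc (1/2:ℝ) 1,
      ∀ b ∈ Set.Icc (1/2:ℝ) 1, 0 ≤ s * Gp p a b + q * (b - a) ^ 2 := by
    intro s q h a ha b hb
    have cv : ConvexOn ℝ (Set.Icc (1/2:ℝ) 1) (fun z => s * z ^ p + q * z ^ 2) := by
      refine convexOn_of_hasDerivWithinAt2_nonneg (convex_Icc _ _)
        (fun z hz => (d1 s q z hz).continuousAt.continuousWithinAt)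
        (fun z hz => (d1 s q z (interior_subset hz)).hasDerivWithinAt)
        (fun z hz => (d2 s q z (interior_subset hz)).hasDerivWithinAt)
        (fun z hz => h z (interior_subset hz))
    have := tangent cv ha hb (d1 s q a ha)
    simp only [Gp]
    rw [abs_of_nonneg (by linarith [ha.1] : 0 ≤ a), abs_of_nonneg (by linarith [hb.1] : 0 ≤ b)]
    nlinarith
  refine ⟨p * (p - 1) * x ^ (p - 2) / 2, p * (p - 1) * y ^ (p - 2) / 2, ?_, ?_⟩
  · have : 0 < x ^ (p - 2) := Real.rpow_pos_of_pos (by linarith [hx.1]) _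
    positivity
  · intro a ha b hb
    have h1 := conv 1 (-(p * (p - 1) * x ^ (p - 2) / 2)) (by
      intro z hz
      have h : x ^ (p - 2) ≤ z ^ (p - 2) := hmin hz
      have := mul_le_mul_of_nonneg_left h hp1.le
      linarith) a ha b hb
    have h2 := conv (-1) (p * (p - 1) * y ^ (p - 2) / 2) (by
      intro z hz
      have h : z ^ (p - 2) ≤ y ^ (p - 2) := hmax hz
      have := mul_le_mul_of_nonneg_left h hp1.le
      linarith) a ha b hb
    constructor <;> linarith

theorem far (p : ℝ) (hp : 1 < p) : ∃ k K : ℝ, 0 < k ∧ ∀ a b : ℝ, 0 ≤ a → max |a| |b| = 1 →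
    1/2 ≤ |b - a| → k * (b - a) ^ 2 ≤ Gp p a b ∧ Gp p a b ≤ K * (b - a) ^ 2 := by
  let S : Set (ℝ × ℝ) := {x | 0 ≤ x.1 ∧ max |x.1| |x.2| = 1 ∧ 1/2 ≤ |x.2 - x.1|}
  have hS : IsCompact S := by
    refine (isCompact_Icc (a := ((-1, -1) : ℝ × ℝ)) (b := (1, 1))).of_isClosed_subset ?_ ?_
    · refine (isClosed_le continuous_const continuous_fst).inter
        ((isClosed_eq (continuous_fst.abs.max continuous_snd.abs) continuous_const).inter
          (isClosed_le continuous_const (continuous_snd.sub continuous_fst).abs))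
    · rintro ⟨a, b⟩ ⟨_, h, _⟩
      have h1 := abs_le.1 ((le_max_left |a| |b|).trans h.le)
      have h2 := abs_le.1 ((le_max_right |a| |b|).trans h.le)
      exact ⟨⟨h1.1, h2.1⟩, ⟨h1.2, h2.2⟩⟩
  have hne : S.Nonempty := ⟨(1, 0), by norm_num [S]⟩
  obtain ⟨x, hx, hmin⟩ := hS.exists_isMinOn hne (Gp_cont p hp).continuousOn
  obtain ⟨y, hy, hmax⟩ := hS.exists_isMaxOn hne (Gp_cont p hp).continuousOn
  have pos : ∀ x ∈ S, 0 < Gp p x.1 x.2 := by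
    rintro ⟨a, b⟩ ⟨h1, _, h3⟩
    refine Gp_pos p a b hp h1 ?_
    rintro rfl
    norm_num at h3
  have px := pos x hx
  have py := pos y hy
  refine ⟨Gp p x.1 x.2 / 4, 4 * Gp p y.1 y.2, by positivity, ?_⟩
  intro a b ha hm hd
  have hab : (a, b) ∈ S := ⟨ha, hm, hd⟩
  have l : Gp p x.1 x.2 ≤ Gp p a b := hmin hab
  have u : Gp p a b ≤ Gp p y.1 y.2 := hmax hab
  have h1 := (le_max_left |a| |b|).trans hm.le
  have h2 := (le_max_right |a| |b|).trans hm.le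
  have h3 : |b - a| ≤ 2 := (abs_sub b a).trans (by linarith)
  have h4 : (b - a) ^ 2 ≤ 4 := by rw [← sq_abs]; nlinarith [abs_nonneg (b - a)]
  have h5 : 1/4 ≤ (b - a) ^ 2 := by rw [← sq_abs]; nlinarith
  constructor <;> nlinarith

theorem unit_case (p : ℝ) (hp : 1 < p) : ∃ c C : ℝ, 0 < c ∧ c ≤ C ∧ ∀ a b : ℝ, 0 ≤ a →
    max |a| |b| = 1 → c * (b - a) ^ 2 ≤ Gp p a b ∧ Gp p a b ≤ C * (b - a) ^ 2 := by
  obtain ⟨k, K, hk, h⟩ := near p hp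
  obtain ⟨k', K', hk', h'⟩ := far p hp
  refine ⟨min k k', max (max K K') (min k k'), lt_min hk hk', le_max_right _ _, ?_⟩
  intro a b ha hm
  have key : ∃ c C : ℝ, min k k' ≤ c ∧ C ≤ max (max K K') (min k k') ∧
      c * (b - a) ^ 2 ≤ Gp p a b ∧ Gp p a b ≤ C * (b - a) ^ 2 := by
    rcases le_or_gt (1/2) |b - a| with hd | hd
    · exact ⟨k', K', min_le_right _ _, (le_max_right _ _).trans (le_max_left _ _), h' a b ha hm hd⟩
    · refine ⟨k, K, min_le_left _ _, (le_max_left _ _).trans (le_max_left _ _), ?_⟩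
      have h1 := abs_le.1 ((le_max_left |a| |b|).trans hm.le)
      have h2 := abs_le.1 ((le_max_right |a| |b|).trans hm.le)
      have h3 := abs_lt.1 hd
      have h4 : a = 1 ∨ b = 1 := by
        rcases max_choice |a| |b| with e | e
        · left; rw [← abs_of_nonneg ha]; linarith
        · right
          have : |b| = 1 := by linarith
          rcases (abs_eq (by norm_num)).1 this with e | e
          · exact e
          · linarith
      refine h a ⟨?_, h1.2⟩ b ⟨?_, h2.2⟩ <;> rcases h4 with e | e <;> linarith
  obtain ⟨c, C, hc, hC, l, u⟩ := key
  exact ⟨(mul_le_mul_of_nonneg_right hc (sq_nonneg _)).trans l,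
    u.trans (mul_le_mul_of_nonneg_right hC (sq_nonneg _))⟩

/-- For every `p > 1` there are constants `0 < c ≤ C` with
`c (b−a)² (|a| ∨ |b|)^(p−2) ≤ F_p(a,b) ≤ C (b−a)² (|a| ∨ |b|)^(p−2)` for all `a, b ∈ ℝ`.
(Here real exponentiation satisfies `0 ^ y = 0` for `y ≠ 0`, so in the degenerate case
`a = b = 0`, and for `p < 2` whenever `a = b`, both outer expressions equal `0`.) -/
theorem Fp_comparable (p : ℝ) (hp : 1 < p) :
    ∃ c C : ℝ, 0 < c ∧ c ≤ C ∧ ∀ a b : ℝ,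
      c * (b - a) ^ 2 * (max |a| |b|) ^ (p - 2) ≤ Fp p a b ∧
      Fp p a b ≤ C * (b - a) ^ 2 * (max |a| |b|) ^ (p - 2) := by
  obtain ⟨c, C, hc, hcC, h⟩ := unit_case p hp
  refine ⟨c, C, hc, hcC, ?_⟩
  have main : ∀ a b : ℝ, 0 ≤ a → c * (b - a) ^ 2 * (max |a| |b|) ^ (p - 2) ≤ Fp p a b ∧
      Fp p a b ≤ C * (b - a) ^ 2 * (max |a| |b|) ^ (p - 2) := by
    intro a b ha
    rw [Fp_eq_Gp p a b hp ha]
    rcases (le_max_of_le_left (abs_nonneg a) : 0 ≤ max |a| |b|).eq_or_lt with h0 | h0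
    · have h1 : a = 0 := abs_nonpos_iff.1 ((le_max_left |a| |b|).trans h0.ge)
      have h2 : b = 0 := abs_nonpos_iff.1 ((le_max_right |a| |b|).trans h0.ge)
      subst h1 h2
      simp [Gp]
    · set m := max |a| |b| with hm
      have hm1 : max |a / m| |b / m| = 1 := by
        rw [abs_div, abs_div, abs_of_pos h0, max_div_div_right h0.le, ← hm, div_self h0.ne']
      obtain ⟨l, u⟩ := h (a / m) (b / m) (by positivity) hm1
      have e : Gp p a b = m ^ p * Gp p (a / m) (b / m) := by
        rw [← Gp_scale p _ _ m h0]; congr 1 <;> field_simp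
      have e2 : m ^ p = m ^ (p - 2) * m ^ 2 := by
        rw [← Real.rpow_natCast m 2, ← Real.rpow_add h0]; norm_num
      have e3 : ∀ c : ℝ, c * (b - a) ^ 2 * m ^ (p - 2)
          = m ^ p * (c * (b / m - a / m) ^ 2) := by
        intro c; rw [e2]; field_simp
      have hmp := (Real.rpow_pos_of_pos h0 p).le
      rw [e, e3, e3]
      exact ⟨mul_le_mul_of_nonneg_left l hmp, mul_le_mul_of_nonneg_left u hmp⟩
  intro a b
  rcases le_total 0 a with ha | ha
  · exact main a b ha
  · have := main (-a) (-b) (by linarith)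
    rw [Fp_neg p a b hp, abs_neg, abs_neg, show (-b - -a) ^ 2 = (b - a) ^ 2 by ring] at this
    exact this
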